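/- Suppose α > 0, n ≥ 1, and 1 ≤ l ≤ n. Then the Jack_α probability that the largest part of λ equals l is at most n!/((n−l)!·l!·α^{l−1}·(l−1)!); that is, Σ_{λ partition of n with λ_1 = l} π_α(λ) ≤ n!/((n−l)!·l!) · 1/(α^{l−1}·(l−1)!). -/

import Mathlib

open Finset

namespace JackTest

def colLen {n : ℕ} (lam : n.Partition) (j : ℕ) : ℕ :=
  (lam.parts.filter (fun p => j < p)).card

def rowLen {n : ℕ} (lam : n.Partition) (i : ℕ) : ℕ :=
  ((Finset.range n).filter (fun j => i < colLen lam j)).card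

def cells {n : ℕ} (lam : n.Partition) : Finset (ℕ × ℕ) :=
  (Finset.range n ×ˢ Finset.range n).filter (fun s => s.2 < rowLen lam s.1)

def arm {n : ℕ} (lam : n.Partition) (s : ℕ × ℕ) : ℕ := rowLen lam s.1 - (s.2 + 1)

def leg {n : ℕ} (lam : n.Partition) (s : ℕ × ℕ) : ℕ := colLen lam s.2 - (s.1 + 1)

noncomputable def cLow (α : ℝ) {n : ℕ} (lam : n.Partition) : ℝ :=
  ∏ s ∈ cells lam, (α * arm lam s + leg lam s + 1)

noncomputable def cUp (α : ℝ) {n : ℕ} (lam : n.Partition) : ℝ :=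
  ∏ s ∈ cells lam, (α * arm lam s + leg lam s + α)

noncomputable def jackP (α : ℝ) {n : ℕ} (lam : n.Partition) : ℝ :=
  α ^ n * (n.factorial) / (cLow α lam * cUp α lam)

def nStat {n : ℕ} (lam : n.Partition) : ℕ := ∑ i ∈ Finset.range n, i * rowLen lam i

def nStatConj {n : ℕ} (lam : n.Partition) : ℕ := ∑ j ∈ Finset.range n, j * colLen lam j

noncomputable def W (α : ℝ) {n : ℕ} (lam : n.Partition) : ℝ :=
  (α * nStatConj lam - nStat lam) / Real.sqrt (α * n.choose 2)

noncomputable def Phi (x : ℝ) : ℝ :=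
  (Real.sqrt (2 * Real.pi))⁻¹ * ∫ t in Set.Iic x, Real.exp (-t ^ 2 / 2)


open Polynomial in
/-- The three leading coefficients of a product of linear factors, shifted by two so that no
subtraction of indices is needed. -/
theorem coeff_prod_X_sub_C_mul_X_sq {ι : Type*} (s : Finset ι) (y : ι → ℝ) :
    ((∏ i ∈ s, (X - C (y i))) * X ^ 2).coeff (#s + 1) = -∑ i ∈ s, y i ∧
    ((∏ i ∈ s, (X - C (y i))) * X ^ 2).coeff (#s) =
      ((∑ i ∈ s, y i) ^ 2 - ∑ i ∈ s, y i ^ 2) / 2 := by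
  classical
  have hlead : ∀ t : Finset ι, ((∏ i ∈ t, (X - C (y i))) * X ^ 2).coeff (#t + 2) = 1 := by
    intro t
    rw [coeff_mul_X_pow]
    have h := monic_prod_X_sub_C y t
    rw [Monic, leadingCoeff, natDegree_finsetProd_X_sub_C_eq_card] at h
    exact h
  induction s using Finset.induction_on with
  | empty => simp [coeff_X_pow]
  | insert a s ha ih =>
    have hl := hlead s
    have hmul : (∏ i ∈ insert a s, (X - C (y i))) * X ^ 2 =
        ((∏ i ∈ s, (X - C (y i))) * X ^ 2) * (X - C (y a)) := by
      rw [prod_insert ha]; ring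
    rw [hmul, card_insert_of_notMem ha, sum_insert ha, sum_insert ha, coeff_mul_X_sub_C,
      coeff_mul_X_sub_C, ih.1, ih.2, hl]
    constructor <;> ring

open Polynomial in
theorem sum_lagrange_monic {ι : Type*} [DecidableEq ι] (s t : Finset ι) (x z : ι → ℝ)
    (hx : Set.InjOn x s) (hst : #t + 1 = #s) :
    ∑ k ∈ s, (∏ i ∈ t, (x k - z i)) / ∏ i ∈ s.erase k, (x k - x i) = 1 := by
  have hdeg : (∏ i ∈ t, (X - C (z i))).natDegree = #t := natDegree_finsetProd_X_sub_C_eq_card t z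
  have hmon : (∏ i ∈ t, (X - C (z i))).Monic := monic_prod_X_sub_C z t
  have h := Lagrange.coeff_eq_sum (s := s) hx (P := ∏ i ∈ t, (X - C (z i))) (by
    rw [degree_eq_natDegree hmon.ne_zero, hdeg]
    exact_mod_cast (by omega : #t < #s))
  rw [← hst, Nat.add_sub_cancel, ← hdeg] at h
  have h1 : (∏ i ∈ t, (X - C (z i))).coeff (∏ i ∈ t, (X - C (z i))).natDegree = 1 := hmon
  rw [h1] at h
  rw [h]
  simp [eval_prod]

open Polynomial in
theorem sum_lagrange_shift {ι : Type*} [DecidableEq ι] (s : Finset ι) (y : ι → ℝ) (t : ℝ)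
    (hy : Set.InjOn y s) :
    ∑ k ∈ s, (y k + t) * ∏ i ∈ s.erase k, ((y k - y i - 1) / (y k - y i)) =
      ∑ i ∈ s, y i + t * #s - #s * (#s - 1) / 2 := by
  rcases s.eq_empty_or_nonempty with rfl | hne
  · simp
  obtain ⟨m, hm⟩ : ∃ m, #s = m + 1 := ⟨#s - 1, by have := hne.card_pos; omega⟩
  set Q : ℝ[X] := ∏ i ∈ s, (X - C (y i)) with hQ
  set R : ℝ[X] := ∏ i ∈ s, (X - C (y i + 1)) with hR
  have hQd : Q.natDegree = m + 1 := hm ▸ natDegree_finsetProd_X_sub_C_eq_card s y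
  have hRd : R.natDegree = m + 1 := hm ▸ natDegree_finsetProd_X_sub_C_eq_card s _
  have hQ1 : Q.coeff (m + 1) = 1 := by rw [← hQd]; exact monic_prod_X_sub_C y s
  have hR1 : R.coeff (m + 1) = 1 := by rw [← hRd]; exact monic_prod_X_sub_C _ s
  obtain ⟨hQa, hQb⟩ := coeff_prod_X_sub_C_mul_X_sq s y
  obtain ⟨hRa, hRb⟩ := coeff_prod_X_sub_C_mul_X_sq s (fun i => y i + 1)
  rw [← hQ] at hQa hQb
  rw [← hR] at hRa hRb
  rw [hm, show m + 1 + 1 = m + 2 by ring, coeff_mul_X_pow] at hQa hRa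
  rw [hm] at hQb hRb
  have hsq : ∑ i ∈ s, (y i + 1) ^ 2 = ∑ i ∈ s, y i ^ 2 + 2 * ∑ i ∈ s, y i + (m + 1) := by
    simp only [add_sq, sum_add_distrib, mul_one, ← mul_sum]
    simp [hm]
  have hs1 : ∑ i ∈ s, (y i + 1) = ∑ i ∈ s, y i + (m + 1) := by
    simp [sum_add_distrib, hm]
  rw [hs1] at hRa
  rw [hsq, hs1] at hRb
  set D : ℝ[X] := (R - Q) * X + C t * (R - Q) + C ((m : ℝ) + 1) * Q with hD
  have hDlt : D.degree < #s := by
    rw [hm, degree_lt_iff_coeff_zero]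
    intro j hj
    obtain ⟨i, rfl⟩ : ∃ i, j = i + 1 := ⟨j - 1, by omega⟩
    rcases Nat.eq_or_lt_of_le hj with h | h
    · obtain rfl : m = i := by omega
      simp only [hD, coeff_add, coeff_mul_X, coeff_C_mul, coeff_sub, hQ1, hR1, hQa, hRa]
      ring
    · have e1 : Q.coeff (i + 1) = 0 := coeff_eq_zero_of_natDegree_lt (by omega)
      have e2 : R.coeff (i + 1) = 0 := coeff_eq_zero_of_natDegree_lt (by omega)
      have e3 : R.coeff i - Q.coeff i = 0 := by
        rcases Nat.eq_or_lt_of_le (by omega : m + 1 ≤ i) with rfl | h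
        · rw [hQ1, hR1, sub_self]
        · rw [coeff_eq_zero_of_natDegree_lt (by omega : Q.natDegree < i),
            coeff_eq_zero_of_natDegree_lt (by omega : R.natDegree < i), sub_self]
      simp only [hD, coeff_add, coeff_mul_X, coeff_C_mul, coeff_sub, e1, e2, e3]
      ring
  have hDc : D.coeff m = -(∑ i ∈ s, y i + t * #s - #s * (#s - 1) / 2) := by
    have e : D.coeff m = ((R * X ^ 2).coeff (m + 1) - (Q * X ^ 2).coeff (m + 1)) +
        t * (R.coeff m - Q.coeff m) + (m + 1) * Q.coeff m := by
      have h2 : ∀ p : ℝ[X], (p * X ^ 2).coeff (m + 1) = (p * X).coeff m := by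
        intro p
        rw [pow_two, ← mul_assoc, coeff_mul_X]
      simp only [hD, coeff_add, coeff_C_mul, coeff_sub, h2, sub_mul]
    rw [e, hQa, hQb, hRa, hRb, hm]
    push_cast
    ring
  have h := Lagrange.coeff_eq_sum hy hDlt
  rw [hm, Nat.add_sub_cancel, hDc] at h
  rw [neg_eq_iff_eq_neg.mp h, ← sum_neg_distrib]
  refine sum_congr rfl fun k hk => ?_
  have hQk : Q.eval (y k) = 0 := by
    rw [hQ, eval_prod]
    exact prod_eq_zero hk (by simp)
  have hRk : R.eval (y k) = -∏ i ∈ s.erase k, (y k - y i - 1) := by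
    rw [hR, eval_prod, ← mul_prod_erase s _ hk]
    simp [sub_sub]
  simp only [hD, eval_add, eval_mul, eval_sub, eval_X, eval_C, hQk, hRk, prod_div_distrib]
  ring

/-- The number of the first `N` rows of the diagram with row lengths `f` that meet column `j`. -/
def colCount (N : ℕ) (f : ℕ → ℕ) (j : ℕ) : ℕ := #{i ∈ range N | j < f i}

/-- The product of the shifted hook lengths `α a(s) + l(s) + c` over the diagram with row
lengths `f 0, …, f (N - 1)`. -/
noncomputable def hookProd (α c : ℝ) (N : ℕ) (f : ℕ → ℕ) : ℝ :=
  ∏ i ∈ range N, ∏ j ∈ range (f i),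
    (α * (f i - (j + 1) : ℕ) + (colCount N f j - (i + 1) : ℕ) + c)

noncomputable def risingProd (α c : ℝ) (d : ℕ) (k : ℝ) : ℝ :=
  ∏ a ∈ range d, (α * a + k + c)

noncomputable def ratioProd (α c : ℝ) (d : ℕ) (k : ℝ) : ℝ :=
  ∏ a ∈ range d, ((α * a + k - 1 + c) / (α * a + k + c))

theorem ratioProd_succ (α c : ℝ) (d : ℕ) (k : ℝ) :
    ratioProd α c (d + 1) k =
      ratioProd α c d k * ((α * d + k - 1 + c) / (α * d + k + c)) :=
  prod_range_succ _ _

theorem filter_lt_eq_range_colCount (N : ℕ) {f : ℕ → ℕ} (hf : Antitone f) (j : ℕ) :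
    {i ∈ range N | j < f i} = range (colCount N f j) := by
  unfold colCount
  induction N with
  | zero => simp
  | succ N ih =>
    by_cases h : j < f N
    · have e : {i ∈ range (N + 1) | j < f i} = range (N + 1) := by
        refine filter_true_of_mem fun i hi => h.trans_le (hf ?_)
        simpa [Nat.lt_succ_iff] using hi
      rw [e, card_range]
    · rw [range_add_one, filter_insert, if_neg h]
      exact ih

theorem lt_colCount_iff {N : ℕ} {f : ℕ → ℕ} (hf : Antitone f) {i : ℕ} (hi : i < N) (j : ℕ) :
    i < colCount N f j ↔ j < f i := by
  rw [← mem_range, ← filter_lt_eq_range_colCount N hf]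
  simp [hi]

theorem colCount_le (N : ℕ) (f : ℕ → ℕ) (j : ℕ) : colCount N f j ≤ N :=
  (card_filter_le _ _).trans (card_range N).le

theorem prod_Ico_div_succ (T : ℕ → ℝ) {p N : ℕ} (hpN : p ≤ N) (hT : ∀ m, p ≤ m → T m ≠ 0) :
    ∏ m ∈ Ico p N, T m / T (m + 1) = T p / T N := by
  induction N, hpN using Nat.le_induction with
  | base => simp [hT p le_rfl]
  | succ N h ih =>
    rw [prod_Ico_succ_top h, ih, div_mul_div_cancel₀ (hT N h)]

theorem prod_row_eq {α c : ℝ} (hα : 0 < α) (hc : 0 < c) {N : ℕ} {f : ℕ → ℕ}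
    (hf : Antitone f) {i : ℕ} (hi : i < N) :
    ∏ j ∈ range (f i), (α * (f i - (j + 1) : ℕ) + (colCount N f j - (i + 1) : ℕ) + c) =
      risingProd α c (f i) ((N : ℝ) - 1 - i) *
        ∏ m ∈ range N, ratioProd α c (f i - f m) ((m : ℝ) - i) := by
  have hK : ∀ m, ratioProd α c (f i - f m) ((m : ℝ) - i) = ∏ a ∈ range (f i),
      if a < f i - f m then (α * a + ((m : ℝ) - i) - 1 + c) / (α * a + ((m : ℝ) - i) + c)
        else 1 := by
    intro m
    rw [← prod_filter, ratioProd]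
    congr 1
    ext a
    simp only [mem_range, mem_filter]
    omega
  simp only [hK]
  rw [prod_comm, risingProd, ← prod_mul_distrib, ← prod_range_reflect]
  refine prod_congr rfl fun a ha => ?_
  rw [mem_range] at ha
  set p := colCount N f (f i - 1 - a) with hp
  have hip : i < p := (lt_colCount_iff hf hi _).2 (by omega)
  have hpN : p ≤ N := colCount_le N f _
  rw [← prod_filter]
  have hfil : {m ∈ range N | a < f i - f m} = Ico p N := by
    ext m
    simp only [mem_filter, mem_range, mem_Ico]
    constructor
    · rintro ⟨hm, h⟩
      refine ⟨?_, hm⟩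
      by_contra hlt
      have := (lt_colCount_iff hf hm _).1 (not_le.1 hlt)
      omega
    · rintro ⟨h, hm⟩
      refine ⟨hm, ?_⟩
      have := mt (lt_colCount_iff hf hm (f i - 1 - a)).2 (not_lt.2 h)
      omega
  have hTpos : ∀ m : ℕ, p ≤ m → 0 < α * a + ((m : ℝ) - i) - 1 + c := by
    intro m hm
    have h1 : (i : ℝ) + 1 ≤ m := by exact_mod_cast (by omega : i + 1 ≤ m)
    have h2 : 0 ≤ α * a := by positivity
    linarith
  have htel := prod_Ico_div_succ (fun m : ℕ => α * a + ((m : ℝ) - i) - 1 + c) hpN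
    (fun m hm => (hTpos m hm).ne')
  have hcongr : ∀ m : ℕ, α * a + (((m + 1 : ℕ) : ℝ) - i) - 1 + c = α * a + ((m : ℝ) - i) + c := by
    intro m
    push_cast
    ring
  simp only [hcongr] at htel
  rw [hfil, htel, show α * (a : ℝ) + ((N : ℝ) - 1 - i) + c = α * a + ((N : ℝ) - i) - 1 + c by ring,
    mul_div_cancel₀ _ (hTpos N hpN).ne', show f i - (f i - 1 - a + 1) = a by omega,
    Nat.cast_sub (by omega : i + 1 ≤ p)]
  push_cast
  ring

theorem hookProd_eq {α c : ℝ} (hα : 0 < α) (hc : 0 < c) (N : ℕ) {f : ℕ → ℕ} (hf : Antitone f) :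
    hookProd α c N f = (∏ i ∈ range N, risingProd α c (f i) ((N : ℝ) - 1 - i)) *
      ∏ i ∈ range N, ∏ m ∈ range N, ratioProd α c (f i - f m) ((m : ℝ) - i) := by
  rw [hookProd, ← prod_mul_distrib]
  exact prod_congr rfl fun i hi => prod_row_eq hα hc hf (mem_range.1 hi)

theorem hookProd_pos {α c : ℝ} (hα : 0 < α) (hc : 0 < c) (N : ℕ) (f : ℕ → ℕ) :
    0 < hookProd α c N f :=
  prod_pos fun _ _ => prod_pos fun _ _ => by positivity

/-- Split off row and column `k` from a product over a square. -/
theorem prod_prod_eq_erase {ι : Type*} [DecidableEq ι] (s : Finset ι) {k : ι} (hk : k ∈ s)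
    (B : ι → ι → ℝ) :
    ∏ i ∈ s, ∏ m ∈ s, B i m = B k k * (∏ m ∈ s.erase k, B k m * B m k) *
      ∏ i ∈ s.erase k, ∏ m ∈ s.erase k, B i m := by
  rw [← mul_prod_erase s _ hk, ← mul_prod_erase s _ hk, prod_mul_distrib]
  have : ∀ i, ∏ m ∈ s, B i m = B i k * ∏ m ∈ s.erase k, B i m :=
    fun i => (mul_prod_erase s _ hk).symm
  simp only [this, prod_mul_distrib]
  ring

/-- The effect on the hook product of adding a box at the end of row `k`. -/
theorem hookProd_update {α c : ℝ} (hα : 0 < α) (hc : 0 < c) {N : ℕ} {f : ℕ → ℕ} {k : ℕ}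
    (hk : k < N) (hf : Antitone f) (hg : Antitone (Function.update f k (f k + 1))) :
    hookProd α c N (Function.update f k (f k + 1)) = hookProd α c N f *
      (α * f k + ((N : ℝ) - 1 - k) + c) * ∏ m ∈ (range N).erase k,
        if k < m then
          ((α * f k - k) - (α * f m - m) - 1 + c) / ((α * f k - k) - (α * f m - m) + c)
        else ((α * f k - k) - (α * f m - m) + α - c) /
          ((α * f k - k) - (α * f m - m) + α + 1 - c) := by
  set g := Function.update f k (f k + 1) with hgdef
  have hgk : g k = f k + 1 := by simp [hgdef]
  have hgm : ∀ m, m ≠ k → g m = f m := fun m hm => by simp [hgdef, hm]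
  have hkN := mem_range.2 hk
  rw [hookProd_eq hα hc N hf, hookProd_eq hα hc N hg, prod_prod_eq_erase _ hkN,
    prod_prod_eq_erase (range N) hkN (fun i m => ratioProd α c (f i - f m) _),
    ← mul_prod_erase _ (fun i => risingProd α c (g i) _) hkN,
    ← mul_prod_erase _ (fun i => risingProd α c (f i) _) hkN]
  have h1 : ∏ i ∈ (range N).erase k, risingProd α c (g i) ((N : ℝ) - 1 - i) =
      ∏ i ∈ (range N).erase k, risingProd α c (f i) ((N : ℝ) - 1 - i) :=
    prod_congr rfl fun i hi => by rw [hgm i (ne_of_mem_erase hi)]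
  have h2 : ∏ i ∈ (range N).erase k, ∏ m ∈ (range N).erase k,
        ratioProd α c (g i - g m) ((m : ℝ) - i) =
      ∏ i ∈ (range N).erase k, ∏ m ∈ (range N).erase k,
        ratioProd α c (f i - f m) ((m : ℝ) - i) :=
    prod_congr rfl fun i hi => prod_congr rfl fun m hm => by
      rw [hgm i (ne_of_mem_erase hi), hgm m (ne_of_mem_erase hm)]
  have h3 : risingProd α c (g k) ((N : ℝ) - 1 - k) =
      risingProd α c (f k) ((N : ℝ) - 1 - k) * (α * f k + ((N : ℝ) - 1 - k) + c) := by
    rw [hgk, risingProd, prod_range_succ, ← risingProd]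
  have h4 : ∏ m ∈ (range N).erase k, ratioProd α c (g k - g m) ((m : ℝ) - k) *
        ratioProd α c (g m - g k) ((k : ℝ) - m) =
      (∏ m ∈ (range N).erase k, ratioProd α c (f k - f m) ((m : ℝ) - k) *
        ratioProd α c (f m - f k) ((k : ℝ) - m)) * ∏ m ∈ (range N).erase k,
        if k < m then
          ((α * f k - k) - (α * f m - m) - 1 + c) / ((α * f k - k) - (α * f m - m) + c)
        else ((α * f k - k) - (α * f m - m) + α - c) /
          ((α * f k - k) - (α * f m - m) + α + 1 - c) := by
    rw [← prod_mul_distrib]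
    refine prod_congr rfl fun m hm => ?_
    have hmk := ne_of_mem_erase hm
    rw [hgm m hmk, hgk]
    split_ifs with hlt
    · have hle := hf hlt.le
      rw [show f m - (f k + 1) = 0 by omega, show f m - f k = 0 by omega,
        show f k + 1 - f m = f k - f m + 1 by omega, ratioProd_succ, Nat.cast_sub hle]
      rw [show α * ((f k : ℝ) - f m) + ((m : ℝ) - k) = (α * f k - k) - (α * f m - m) by ring]
      ring
    · have hmk' : m < k := by omega
      have hle : f k + 1 ≤ f m := by
        have := hg hmk'.le
        rwa [hgk, hgm m hmk] at this
      obtain ⟨d, hd⟩ : ∃ d, f m = f k + 1 + d := ⟨f m - (f k + 1), by omega⟩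
      have hmk1 : (m : ℝ) + 1 ≤ k := by exact_mod_cast hmk'
      have hpos : 0 ≤ α * d := by positivity
      rw [show f m - (f k + 1) = d by omega, show f m - f k = d + 1 by omega,
        show f k + 1 - f m = 0 by omega, show f k - f m = 0 by omega, ratioProd_succ, hd]
      push_cast
      have e1 : (α * f k - k) - (α * (f k + 1 + d) - m) + α - c =
        -(α * d + ((k : ℝ) - m) + c) := by ring
      have e2 : (α * f k - k) - (α * (f k + 1 + d) - m) + α + 1 - c =
        -(α * d + ((k : ℝ) - m) - 1 + c) := by ring
      have p1 : α * d + ((k : ℝ) - m) + c ≠ 0 := by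
        apply ne_of_gt; linarith
      have p2 : α * d + ((k : ℝ) - m) - 1 + c ≠ 0 := by
        apply ne_of_gt; linarith
      rw [e1, e2, neg_div_neg_eq]
      field_simp
  rw [h1, h2, h3, h4]
  simp only [Nat.sub_self]
  ring

noncomputable def jackHook (α : ℝ) (N : ℕ) (f : ℕ → ℕ) : ℝ :=
  hookProd α 1 N f * hookProd α α N f

theorem jackHook_pos {α : ℝ} (hα : 0 < α) (N : ℕ) (f : ℕ → ℕ) : 0 < jackHook α N f :=
  mul_pos (hookProd_pos hα one_pos N f) (hookProd_pos hα hα N f)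

/-- The transition weight for adding a box to row `k`. -/
noncomputable def upWeight (α : ℝ) (N : ℕ) (f : ℕ → ℕ) (k : ℕ) : ℝ :=
  (∏ m ∈ (range N).erase k, (((α * f k - k) - (α * f m - m) + 1) /
    ((α * f k - k) - (α * f m - m)))) / (α * f k - k + N)

/-- The cotransition weight for removing a box from row `k`. -/
noncomputable def downWeight (α : ℝ) (N : ℕ) (g : ℕ → ℕ) (k : ℕ) : ℝ :=
  (α * g k - k - 1 + N) * ∏ m ∈ (range N).erase k,
    (((α * g k - k - 1) - (α * g m - m - 1) - 1) / ((α * g k - k - 1) - (α * g m - m - 1)))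

theorem downWeight_div_jackHook {α : ℝ} (hα : 0 < α) {N : ℕ} {f : ℕ → ℕ} {k : ℕ}
    (hk : k < N) (hf : Antitone f) (hg : Antitone (Function.update f k (f k + 1))) :
    downWeight α N (Function.update f k (f k + 1)) k /
        jackHook α N (Function.update f k (f k + 1)) =
      upWeight α N f k / jackHook α N f := by
  have hH := hookProd_update hα one_pos hk hf hg
  have hH' := hookProd_update hα hα hk hf hg
  have hpos := hookProd_pos hα one_pos N f
  have hpos' := hookProd_pos hα hα N f
  have hkN : (k : ℝ) + 1 ≤ N := by exact_mod_cast hk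
  have hfk : 0 ≤ α * f k := by positivity
  rw [jackHook, jackHook, hH, hH', downWeight, upWeight]
  set g := Function.update f k (f k + 1) with hgdef
  have hgk : g k = f k + 1 := by simp [hgdef]
  have hgm : ∀ m, m ≠ k → g m = f m := fun m hm => by simp [hgdef, hm]
  have hD : ∏ m ∈ (range N).erase k,
      (((α * g k - k - 1) - (α * g m - m - 1) - 1) / ((α * g k - k - 1) - (α * g m - m - 1))) =
      (∏ m ∈ (range N).erase k, (((α * f k - k) - (α * f m - m) + 1) /
        ((α * f k - k) - (α * f m - m)))) *
      ((∏ m ∈ (range N).erase k, if k < m then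
          ((α * f k - k) - (α * f m - m) - 1 + 1) / ((α * f k - k) - (α * f m - m) + 1)
        else ((α * f k - k) - (α * f m - m) + α - 1) /
          ((α * f k - k) - (α * f m - m) + α + 1 - 1)) *
       (∏ m ∈ (range N).erase k, if k < m then
          ((α * f k - k) - (α * f m - m) - 1 + α) / ((α * f k - k) - (α * f m - m) + α)
        else ((α * f k - k) - (α * f m - m) + α - α) /
          ((α * f k - k) - (α * f m - m) + α + 1 - α))) := by
    rw [← prod_mul_distrib, ← prod_mul_distrib]
    refine prod_congr rfl fun m hm => ?_
    have hmk := ne_of_mem_erase hm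
    rw [hgm m hmk, hgk]
    push_cast
    obtain ⟨D, hDdef⟩ : ∃ D, D = (α * f k - k) - (α * f m - m) := ⟨_, rfl⟩
    rw [show α * ((f k : ℝ) + 1) - k - 1 - (α * f m - m - 1) = D + α by rw [hDdef]; ring, ← hDdef]
    split_ifs with hlt
    · have h1 : (f m : ℝ) ≤ f k := by exact_mod_cast hf hlt.le
      have h2 : (k : ℝ) + 1 ≤ m := by exact_mod_cast hlt
      have h3 : 0 < D := by rw [hDdef]; nlinarith
      have h4 : D + 1 ≠ 0 := by linarith
      have h5 : D + α ≠ 0 := by linarith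
      have h6 := h3.ne'
      rw [sub_add_cancel, div_mul_eq_mul_div, ← mul_assoc]
      field_simp
      ring
    · have hmk' : m < k := by omega
      have hle : (f k : ℝ) + 1 ≤ f m := by
        have := hg hmk'.le
        rw [hgk, hgm m hmk] at this
        exact_mod_cast this
      have h2 : (m : ℝ) + 1 ≤ k := by exact_mod_cast hmk'
      have h3 : D + 1 + α ≤ 0 := by rw [hDdef]; nlinarith
      have h4 : D + 1 ≠ 0 := by linarith
      have h5 : D + α ≠ 0 := by linarith
      have h6 : D ≠ 0 := by linarith
      rw [add_sub_cancel_right, add_sub_cancel_right, show D + α + 1 - α = D + 1 by ring]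
      field_simp
  have hne : ∀ m ∈ (range N).erase k, (k < m → (0:ℝ) < (α * f k - k) - (α * f m - m) ∧
        0 < (α * f k - k) - (α * f m - m) - 1 + α) ∧
      (¬ k < m → (α * f k - k) - (α * f m - m) + 1 + α ≤ (0:ℝ)) := by
    intro m hm
    have hmk := ne_of_mem_erase hm
    constructor
    · intro hlt
      have h1 : (f m : ℝ) ≤ f k := by exact_mod_cast hf hlt.le
      have h2 : (k : ℝ) + 1 ≤ m := by exact_mod_cast hlt
      constructor <;> nlinarith
    · intro hlt
      have hmk' : m < k := by omega
      have hle : (f k : ℝ) + 1 ≤ f m := by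
        have := hg hmk'.le
        rw [hgk, hgm m hmk] at this
        exact_mod_cast this
      have h2 : (m : ℝ) + 1 ≤ k := by exact_mod_cast hmk'
      nlinarith
  have hP1 : (∏ m ∈ (range N).erase k, if k < m then
          ((α * f k - k) - (α * f m - m) - 1 + 1) / ((α * f k - k) - (α * f m - m) + 1)
        else ((α * f k - k) - (α * f m - m) + α - 1) /
          ((α * f k - k) - (α * f m - m) + α + 1 - 1)) ≠ 0 := by
    refine prod_ne_zero_iff.2 fun m hm => ?_
    split_ifs with hlt
    · obtain ⟨a, b⟩ := (hne m hm).1 hlt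
      exact div_ne_zero (by linarith) (by linarith)
    · have := (hne m hm).2 hlt
      exact div_ne_zero (by linarith) (by linarith)
  have hP2 : (∏ m ∈ (range N).erase k, if k < m then
          ((α * f k - k) - (α * f m - m) - 1 + α) / ((α * f k - k) - (α * f m - m) + α)
        else ((α * f k - k) - (α * f m - m) + α - α) /
          ((α * f k - k) - (α * f m - m) + α + 1 - α)) ≠ 0 := by
    refine prod_ne_zero_iff.2 fun m hm => ?_
    split_ifs with hlt
    · obtain ⟨a, b⟩ := (hne m hm).1 hlt
      exact div_ne_zero (by linarith) (by linarith)
    · have := (hne m hm).2 hlt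
      exact div_ne_zero (by linarith) (by linarith)
  rw [hD, hgk]
  generalize (∏ m ∈ (range N).erase k, if k < m then
          ((α * f k - k) - (α * f m - m) - 1 + 1) / ((α * f k - k) - (α * f m - m) + 1)
        else ((α * f k - k) - (α * f m - m) + α - 1) /
          ((α * f k - k) - (α * f m - m) + α + 1 - 1)) = P1 at hP1 ⊢
  generalize (∏ m ∈ (range N).erase k, if k < m then
          ((α * f k - k) - (α * f m - m) - 1 + α) / ((α * f k - k) - (α * f m - m) + α)
        else ((α * f k - k) - (α * f m - m) + α - α) /
          ((α * f k - k) - (α * f m - m) + α + 1 - α)) = P2 at hP2 ⊢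
  have e1 : α * f k + ((N : ℝ) - 1 - k) + 1 = α * f k - k + N := by ring
  have e2 : α * f k + ((N : ℝ) - 1 - k) + α = α * ((f k + 1 : ℕ) : ℝ) - k - 1 + N := by
    push_cast; ring
  have e3 : α * ((f k + 1 : ℕ) : ℝ) - k - 1 + N ≠ 0 := by
    push_cast; apply ne_of_gt; linarith
  have e4 : α * f k - k + N ≠ 0 := by apply ne_of_gt; linarith
  rw [e1, e2]
  generalize α * ((f k + 1 : ℕ) : ℝ) - k - 1 + N = A at e3 ⊢
  generalize α * (f k : ℝ) - k + N = A' at e4 ⊢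
  have := hpos.ne'
  have := hpos'.ne'
  field_simp

open Classical in
/-- Row-length sequences of the diagrams with at most `N` rows and exactly `n` boxes. -/
noncomputable def diagrams (N n : ℕ) : Finset (ℕ → ℕ) :=
  {f ∈ piAntidiag (range N) n | Antitone f}

theorem mem_diagrams {N n : ℕ} {f : ℕ → ℕ} :
    f ∈ diagrams N n ↔ ∑ i ∈ range N, f i = n ∧ (∀ i, N ≤ i → f i = 0) ∧ Antitone f := by
  classical
  simp only [diagrams, mem_filter, mem_piAntidiag, mem_range, and_assoc, ne_eq]
  refine and_congr_right fun _ => and_congr_left fun _ => forall_congr' fun i => ?_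
  rw [← not_lt, not_imp_comm]

theorem content_strictAnti {α : ℝ} (hα : 0 < α) {f : ℕ → ℕ} (hf : Antitone f) (b : ℝ) :
    StrictAnti fun i : ℕ => α * f i - i - b := by
  intro i j hij
  have h1 : (f j : ℝ) ≤ f i := by exact_mod_cast hf hij.le
  have h2 : (i : ℝ) < j := by exact_mod_cast hij
  have h3 := mul_le_mul_of_nonneg_left h1 hα.le
  simp only
  linarith

theorem content_strictAnti' {α : ℝ} (hα : 0 < α) {f : ℕ → ℕ} (hf : Antitone f) :
    StrictAnti fun i : ℕ => α * f i - i := by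
  simpa using content_strictAnti hα hf 0

/-- For `m < k`, the content of the box addable to row `k` is at least one below that for row `m`. -/
theorem content_add_one_le {α : ℝ} (hα : 0 < α) {f : ℕ → ℕ} (hf : Antitone f) {m k : ℕ}
    (h : m < k) : (α * f k - k) - (α * f m - m) + 1 ≤ 0 := by
  have h1 : (f k : ℝ) ≤ f m := by exact_mod_cast hf h.le
  have h2 : (m : ℝ) + 1 ≤ k := by exact_mod_cast h
  have h3 := mul_le_mul_of_nonneg_left h1 hα.le
  linarith

theorem content_ratio_nonneg {α : ℝ} (hα : 0 < α) {f : ℕ → ℕ} (hf : Antitone f) {m k : ℕ}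
    (h : m ≠ k) :
    0 ≤ ((α * f k - k) - (α * f m - m) + 1) / ((α * f k - k) - (α * f m - m)) := by
  rcases lt_or_gt_of_ne h with hlt | hlt
  · have := content_add_one_le hα hf hlt
    exact div_nonneg_of_nonpos this (by linarith)
  · have : α * f m - m < α * f k - k := content_strictAnti' hα hf hlt
    exact div_nonneg (by linarith) (by linarith)

theorem upWeight_nonneg {α : ℝ} (hα : 0 < α) {N : ℕ} {f : ℕ → ℕ} (hf : Antitone f) {k : ℕ}
    (hk : k < N) : 0 ≤ upWeight α N f k := by
  have hkN : (k : ℝ) < N := by exact_mod_cast hk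
  have hfk : 0 ≤ α * f k := by positivity
  exact div_nonneg (prod_nonneg fun m hm => content_ratio_nonneg hα hf (ne_of_mem_erase hm))
    (by linarith)

theorem sum_upWeight_le_one {α : ℝ} (hα : 0 < α) {N : ℕ} {f : ℕ → ℕ} (hf : Antitone f)
    (hN : f N = 0) : ∑ k ∈ range N, upWeight α N f k ≤ 1 := by
  have h := sum_lagrange_monic (range (N + 1)) (range N) (fun i => α * f i - i)
    (fun i => α * f i - i - 1) (content_strictAnti' hα hf).injective.injOn (by simp)
  rw [sum_range_succ] at h
  have hlast : 0 ≤ (∏ i ∈ range N, ((α * f N - N) - (α * f i - i - 1))) /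
      ∏ i ∈ (range (N + 1)).erase N, ((α * f N - N) - (α * f i - i)) := by
    rw [range_add_one, erase_insert (by simp), ← prod_div_distrib]
    refine prod_nonneg fun i hi => ?_
    have := content_ratio_nonneg hα hf (mem_range.1 hi).ne
    rwa [← sub_add]
  have hterm : ∑ k ∈ range N, upWeight α N f k =
      ∑ k ∈ range N, (∏ i ∈ range N, ((α * f k - k) - (α * f i - i - 1))) /
        ∏ i ∈ (range (N + 1)).erase k, ((α * f k - k) - (α * f i - i)) := by
    refine sum_congr rfl fun k hk => ?_
    have hkN := (mem_range.1 hk).ne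
    rw [range_add_one, erase_insert_of_ne hkN.symm, prod_insert (by simp), upWeight,
      ← mul_prod_erase _ _ hk, prod_div_distrib, hN, div_div]
    congr 1
    · rw [show (α * f k - k) - (α * f k - k - 1) = 1 by ring, one_mul]
      exact prod_congr rfl fun i _ => by ring
    · push_cast
      ring
  rw [hterm]
  linarith

theorem sum_downWeight {α : ℝ} (hα : 0 < α) {N n : ℕ} {f : ℕ → ℕ} (hf : f ∈ diagrams N n) :
    ∑ k ∈ range N, downWeight α N f k = α * n := by
  obtain ⟨hsum, -, hanti⟩ := mem_diagrams.1 hf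
  have h := sum_lagrange_shift (range N) (fun i => α * f i - i - 1) N
    (content_strictAnti hα hanti 1).injective.injOn
  unfold downWeight
  rw [h, sum_sub_distrib, sum_sub_distrib, ← mul_sum, ← Nat.cast_sum, hsum, card_range]
  have hg : ∑ i ∈ range N, (i : ℝ) = N * (N - 1) / 2 := by
    clear * -
    induction N with
    | zero => simp
    | succ N ih => rw [sum_range_succ, ih]; push_cast; ring
  rw [hg]
  simp
  ring

/-- The cotransition weight vanishes unless the last box of row `k` is removable. -/
theorem lt_of_downWeight_ne_zero {α : ℝ} {N n : ℕ} {g : ℕ → ℕ} (hg : g ∈ diagrams N n) {k : ℕ}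
    (hk : k < N) (h : downWeight α N g k ≠ 0) : g (k + 1) < g k := by
  obtain ⟨-, hz, hanti⟩ := mem_diagrams.1 hg
  refine lt_of_le_of_ne (hanti (Nat.le_succ k)) fun heq => h ?_
  rw [downWeight]
  rcases Nat.eq_or_lt_of_le (Nat.succ_le_of_lt hk) with hN | hlt
  · have h0 : g k = 0 := by rw [← heq]; exact hz _ hN.ge
    rw [h0, ← hN]
    push_cast
    ring
  · refine mul_eq_zero_of_right _ (prod_eq_zero (i := k + 1) (by simpa using hlt) ?_)
    rw [heq]
    push_cast
    ring

theorem exists_update_of_downWeight_ne_zero {α : ℝ} {N n : ℕ} {g : ℕ → ℕ}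
    (hg : g ∈ diagrams N (n + 1)) {k : ℕ} (hk : k < N) (h : downWeight α N g k ≠ 0) :
    Function.update g k (g k - 1) ∈ diagrams N n ∧
      Function.update (Function.update g k (g k - 1)) k
        (Function.update g k (g k - 1) k + 1) = g := by
  have hlt := lt_of_downWeight_ne_zero hg hk h
  obtain ⟨hsum, hz, hanti⟩ := mem_diagrams.1 hg
  refine ⟨mem_diagrams.2 ⟨?_, fun i hi => ?_, antitone_nat_of_succ_le fun i => ?_⟩, ?_⟩
  · have hkN := mem_range.2 hk
    rw [sum_update_of_mem hkN]
    rw [← add_sum_erase _ _ hkN, erase_eq] at hsum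
    omega
  · rw [Function.update_of_ne (by omega)]
    exact hz i hi
  · have := hanti (Nat.le_succ i)
    simp only [Function.update_apply]
    split_ifs with h1 h2 h2
    · omega
    · subst h1
      simp only [Nat.succ_eq_add_one] at this
      omega
    · subst h2
      omega
    · exact this
  · rw [Function.update_idem, Function.update_self, Nat.sub_add_cancel (by omega),
      Function.update_eq_self]

theorem sum_downWeight_div_le {α : ℝ} (hα : 0 < α) {N n k : ℕ} (hk : k < N) :
    ∑ g ∈ diagrams N (n + 1), downWeight α N g k / jackHook α N g ≤
      ∑ f ∈ diagrams N n, upWeight α N f k / jackHook α N f := by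
  classical
  have hnn : ∀ f ∈ diagrams N n, 0 ≤ upWeight α N f k / jackHook α N f := fun f hf =>
    div_nonneg (upWeight_nonneg hα (mem_diagrams.1 hf).2.2 hk) (jackHook_pos hα N f).le
  have hback := fun g (hg : g ∈ diagrams N (n + 1)) h =>
    exists_update_of_downWeight_ne_zero (α := α) hg hk h
  rw [← sum_filter_of_ne (p := fun g => downWeight α N g k ≠ 0)
    (fun g _ h h0 => h (by rw [h0, zero_div]))]
  calc _ = ∑ f ∈ image (fun g => Function.update g k (g k - 1))
          {g ∈ diagrams N (n + 1) | downWeight α N g k ≠ 0},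
          upWeight α N f k / jackHook α N f := by
        rw [sum_image]
        · refine sum_congr rfl fun g hg => ?_
          obtain ⟨hg, h⟩ := mem_filter.1 hg
          obtain ⟨hmem, heq⟩ := hback g hg h
          have hs := downWeight_div_jackHook hα hk (mem_diagrams.1 hmem).2.2
            (by rw [heq]; exact (mem_diagrams.1 hg).2.2)
          rw [heq] at hs
          exact hs
        · intro g hg g' hg' he
          obtain ⟨hg, h⟩ := mem_filter.1 hg
          obtain ⟨hg', h'⟩ := mem_filter.1 hg'
          simp only at he
          rw [← (hback g hg h).2, ← (hback g' hg' h').2, he]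
    _ ≤ _ := by
        refine sum_le_sum_of_subset_of_nonneg (fun f hf => ?_) fun f hf _ => hnn f hf
        obtain ⟨g, hg, rfl⟩ := mem_image.1 hf
        obtain ⟨hg, h⟩ := mem_filter.1 hg
        exact (hback g hg h).1

theorem sum_inv_jackHook_succ_le {α : ℝ} (hα : 0 < α) (N n : ℕ) :
    α * (n + 1) * ∑ g ∈ diagrams N (n + 1), (jackHook α N g)⁻¹ ≤
      ∑ f ∈ diagrams N n, (jackHook α N f)⁻¹ :=
  calc α * (n + 1) * ∑ g ∈ diagrams N (n + 1), (jackHook α N g)⁻¹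
      = ∑ g ∈ diagrams N (n + 1), ∑ k ∈ range N, downWeight α N g k / jackHook α N g := by
        rw [mul_sum]
        refine sum_congr rfl fun g hg => ?_
        rw [← sum_div, sum_downWeight hα hg, div_eq_mul_inv]
        push_cast
        ring
    _ = ∑ k ∈ range N, ∑ g ∈ diagrams N (n + 1), downWeight α N g k / jackHook α N g := sum_comm
    _ ≤ ∑ k ∈ range N, ∑ f ∈ diagrams N n, upWeight α N f k / jackHook α N f :=
        sum_le_sum fun k hk => sum_downWeight_div_le hα (mem_range.1 hk)
    _ = ∑ f ∈ diagrams N n, ∑ k ∈ range N, upWeight α N f k / jackHook α N f := sum_comm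
    _ ≤ _ := by
        refine sum_le_sum fun f hf => ?_
        obtain ⟨-, hz, hanti⟩ := mem_diagrams.1 hf
        rw [← sum_div, ← one_div]
        exact div_le_div_of_nonneg_right (sum_upWeight_le_one hα hanti (hz N le_rfl))
          (jackHook_pos hα N f).le

/-- The Jack measure on diagrams with at most `N` rows has total mass at most one. -/
theorem sum_inv_jackHook_le {α : ℝ} (hα : 0 < α) (N n : ℕ) :
    ∑ f ∈ diagrams N n, (jackHook α N f)⁻¹ ≤ 1 / (α ^ n * n.factorial) := by
  classical
  induction n with
  | zero =>
    have h0 : diagrams N 0 ⊆ {0} := fun f hf => by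
      have := (mem_filter.1 hf).1
      rwa [piAntidiag_zero] at this
    refine (sum_le_sum_of_subset_of_nonneg h0 fun f _ _ =>
      (inv_pos.2 (jackHook_pos hα N f)).le).trans ?_
    simp [jackHook, hookProd]
  | succ n ih =>
    have h := (sum_inv_jackHook_succ_le hα N n).trans ih
    have hp : 0 < α * ((n : ℝ) + 1) := by positivity
    rw [← le_div_iff₀' hp] at h
    refine h.trans (le_of_eq ?_)
    rw [div_div, Nat.factorial_succ]
    push_cast
    ring

theorem colCount_succ (N : ℕ) (f : ℕ → ℕ) {j : ℕ} (hj : j < f 0) :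
    colCount (N + 1) f j = colCount N (fun i => f (i + 1)) j + 1 := by
  rw [colCount, colCount, card_filter, card_filter, sum_range_succ', if_pos hj]

/-- Remove the first row of a diagram. -/
theorem hookProd_succ (α c : ℝ) (N : ℕ) {f : ℕ → ℕ} (hf : Antitone f) :
    hookProd α c (N + 1) f = hookProd α c N (fun i => f (i + 1)) *
      ∏ j ∈ range (f 0), (α * (f 0 - (j + 1) : ℕ) + (colCount (N + 1) f j - 1 : ℕ) + c) := by
  rw [hookProd, prod_range_succ, ← prod_range_succ, prod_range_succ', hookProd]
  congr 1
  refine prod_congr rfl fun i _ => prod_congr rfl fun j hj => ?_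
  rw [colCount_succ N f ((mem_range.1 hj).trans_le (hf (Nat.zero_le _))), Nat.add_sub_add_right]

theorem le_prod_row_alpha {α : ℝ} (hα : 0 < α) (l : ℕ) (e : ℕ → ℕ) :
    α ^ l * l.factorial ≤ ∏ j ∈ range l, (α * (l - (j + 1) : ℕ) + e j + α) := by
  have h : α ^ l * l.factorial = ∏ j ∈ range l, (α * (l - (j + 1) : ℕ) + α) := by
    rw [← prod_range_reflect]
    have : ∀ j ∈ range l, α * ((l - (l - 1 - j + 1) : ℕ) : ℝ) + α = α * ((j : ℝ) + 1) := by
      intro j hj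
      rw [show l - (l - 1 - j + 1) = j by have := mem_range.1 hj; omega]
      ring
    rw [prod_congr rfl this, prod_mul_distrib, prod_const, card_range,
      ← prod_range_add_one_eq_factorial]
    push_cast
    rfl
  rw [h]
  refine prod_le_prod (fun j _ => by positivity) fun j _ => ?_
  have : (0 : ℝ) ≤ e j := by positivity
  linarith

theorem le_prod_row_one {α : ℝ} (hα : 0 < α) (l : ℕ) (e : ℕ → ℕ) :
    α ^ l * l.factorial ≤ ∏ j ∈ range (l + 1), (α * (l + 1 - (j + 1) : ℕ) + e j + 1) := by
  rw [prod_range_succ]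
  have h : α ^ l * l.factorial = ∏ j ∈ range l, (α * (l + 1 - (j + 1) : ℕ)) := by
    rw [← prod_range_reflect]
    have : ∀ j ∈ range l, α * ((l + 1 - (l - 1 - j + 1) : ℕ) : ℝ) = α * ((j : ℝ) + 1) := by
      intro j hj
      rw [show l + 1 - (l - 1 - j + 1) = j + 1 by have := mem_range.1 hj; omega]
      push_cast
      ring
    rw [prod_congr rfl this, prod_mul_distrib, prod_const, card_range,
      ← prod_range_add_one_eq_factorial]
    push_cast
    rfl
  rw [h]
  have h1 : (1 : ℝ) ≤ α * (l + 1 - (l + 1) : ℕ) + e l + 1 := by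
    have : (0 : ℝ) ≤ α * (l + 1 - (l + 1) : ℕ) + e l := by positivity
    linarith
  refine (prod_le_prod (fun j _ => by positivity) fun j _ => ?_).trans
    (le_mul_of_one_le_right (prod_nonneg fun j _ => by positivity) h1)
  have : (0 : ℝ) ≤ e j := by positivity
  linarith

theorem jackHook_succ_ge {α : ℝ} (hα : 0 < α) (N l : ℕ) {f : ℕ → ℕ} (hf : Antitone f)
    (hl : f 0 = l + 1) :
    jackHook α N (fun i => f (i + 1)) *
      (α ^ l * l.factorial * (α ^ (l + 1) * (l + 1).factorial)) ≤ jackHook α (N + 1) f := by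
  rw [jackHook, jackHook, hookProd_succ α 1 N hf, hookProd_succ α α N hf, hl]
  refine (mul_le_mul_of_nonneg_left ?_ (mul_pos (hookProd_pos hα one_pos N _)
    (hookProd_pos hα hα N _)).le).trans (mul_mul_mul_comm _ _ _ _).le
  exact mul_le_mul (le_prod_row_one hα l _) (le_prod_row_alpha hα (l + 1) _) (by positivity)
    (prod_nonneg fun j _ => by positivity)

theorem sum_inv_jackHook_first_row_le {α : ℝ} (hα : 0 < α) (N m l : ℕ) :
    ∑ f ∈ diagrams (N + 1) (m + (l + 1)) with f 0 = l + 1, (jackHook α (N + 1) f)⁻¹ ≤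
      1 / (α ^ m * m.factorial) *
        (1 / (α ^ l * l.factorial * (α ^ (l + 1) * (l + 1).factorial))) := by
  classical
  set C := α ^ l * l.factorial * (α ^ (l + 1) * (l + 1).factorial) with hC
  have hCpos : 0 < C := by positivity
  calc _ ≤ ∑ f ∈ diagrams (N + 1) (m + (l + 1)) with f 0 = l + 1,
          (jackHook α N (fun i => f (i + 1)))⁻¹ * (1 / C) := by
        refine sum_le_sum fun f hf => ?_
        obtain ⟨hf, hl⟩ := mem_filter.1 hf
        rw [one_div, ← mul_inv]
        exact inv_anti₀ (mul_pos (jackHook_pos hα N _) hCpos)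
          (jackHook_succ_ge hα N l (mem_diagrams.1 hf).2.2 hl)
    _ = ∑ g ∈ image (fun (f : ℕ → ℕ) (i : ℕ) => f (i + 1))
          {f ∈ diagrams (N + 1) (m + (l + 1)) | f 0 = l + 1},
          (jackHook α N g)⁻¹ * (1 / C) := by
        symm
        apply sum_image
        intro f hf f' hf' he
        funext i
        cases i with
        | zero => rw [(mem_filter.1 hf).2, (mem_filter.1 hf').2]
        | succ i => exact congrFun he i
    _ ≤ ∑ g ∈ diagrams N m, (jackHook α N g)⁻¹ * (1 / C) := by
        refine sum_le_sum_of_subset_of_nonneg (fun g hg => ?_) fun g _ _ =>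
          mul_nonneg (inv_pos.2 (jackHook_pos hα N g)).le (one_div_pos.2 hCpos).le
        obtain ⟨f, hf, rfl⟩ := mem_image.1 hg
        obtain ⟨hf, hl⟩ := mem_filter.1 hf
        obtain ⟨hsum, hz, hanti⟩ := mem_diagrams.1 hf
        refine mem_diagrams.2 ⟨?_, fun i hi => hz _ (by omega), fun i j hij => hanti (by omega)⟩
        rw [sum_range_succ'] at hsum
        omega
    _ ≤ _ := by
        rw [← sum_mul]
        exact mul_le_mul_of_nonneg_right (sum_inv_jackHook_le hα N m) (one_div_pos.2 hCpos).le

theorem colLen_antitone {n : ℕ} (lam : n.Partition) : Antitone (colLen lam) := fun _ _ hij =>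
  Multiset.card_le_card (Multiset.monotone_filter_right _ fun _ h => hij.trans_lt h)

theorem colLen_le {n : ℕ} (lam : n.Partition) (j : ℕ) : colLen lam j ≤ n := by
  refine (Multiset.card_le_card (Multiset.filter_le _ _)).trans ?_
  have h := Multiset.card_nsmul_le_sum (s := lam.parts) (a := 1) fun p hp => lam.parts_pos hp
  simpa [lam.parts_sum] using h

theorem colLen_eq_zero {n : ℕ} (lam : n.Partition) {j : ℕ} (hj : n ≤ j) : colLen lam j = 0 := by
  rw [colLen, Multiset.card_eq_zero, Multiset.filter_eq_nil]
  intro p hp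
  have := Multiset.le_sum_of_mem hp
  rw [lam.parts_sum] at this
  omega

theorem lt_rowLen_iff {n : ℕ} (lam : n.Partition) (i j : ℕ) :
    j < rowLen lam i ↔ i < colLen lam j := by
  have h := filter_lt_eq_range_colCount n (colLen_antitone lam) i
  have hr : rowLen lam i = colCount n (colLen lam) i := rfl
  rw [hr, ← mem_range, ← h, mem_filter, mem_range, and_iff_right_iff_imp]
  intro hi
  by_contra hj
  rw [colLen_eq_zero lam (not_lt.1 hj)] at hi
  omega

theorem rowLen_antitone {n : ℕ} (lam : n.Partition) : Antitone (rowLen lam) := fun i k hik => by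
  by_contra! h
  rw [lt_rowLen_iff] at h
  exact lt_irrefl _ ((lt_rowLen_iff lam i _).2 (hik.trans_lt h))

theorem colCount_rowLen {n : ℕ} (lam : n.Partition) (j : ℕ) :
    colCount n (rowLen lam) j = colLen lam j := by
  have h : {i ∈ range n | j < rowLen lam i} = range (colLen lam j) := by
    ext i
    simp only [mem_filter, mem_range, lt_rowLen_iff]
    exact and_iff_right_of_imp fun h => h.trans_le (colLen_le lam j)
  rw [colCount, h, card_range]

theorem sum_colLen {n : ℕ} (lam : n.Partition) : ∑ j ∈ range n, colLen lam j = n := by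
  have key : ∀ s : Multiset ℕ, (∀ p ∈ s, p ≤ n) →
      ∑ j ∈ range n, (s.filter (fun p => j < p)).card = s.sum := by
    intro s
    induction s using Multiset.induction_on with
    | empty => simp
    | cons a s ih =>
      intro h
      have ha : ∑ j ∈ range n, (if j < a then 1 else 0) = a := by
        have hle := h a (Multiset.mem_cons_self a s)
        rw [← card_filter, show {j ∈ range n | j < a} = range a by ext; simp; omega, card_range]
      rw [Multiset.sum_cons, ← ih fun p hp => h p (Multiset.mem_cons_of_mem hp)]
      nth_rw 2 [← ha]
      rw [← sum_add_distrib]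
      refine sum_congr rfl fun j _ => ?_
      rw [Multiset.filter_cons]
      split_ifs <;> simp [add_comm]
  have h := key lam.parts fun p hp => by
    have := Multiset.le_sum_of_mem hp
    rwa [lam.parts_sum] at this
  rwa [lam.parts_sum] at h

theorem sum_rowLen {n : ℕ} (lam : n.Partition) : ∑ i ∈ range n, rowLen lam i = n := by
  conv_rhs => rw [← sum_colLen lam]
  have h : ∀ j, colLen lam j = ∑ i ∈ range n, if i < colLen lam j then 1 else 0 := fun j => by
    nth_rw 1 [← colCount_rowLen, colCount, card_filter]
    simp only [lt_rowLen_iff]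
  rw [sum_congr rfl fun j _ => h j, sum_comm]
  simp only [rowLen, card_filter]

theorem rowLen_mem_diagrams {n : ℕ} (lam : n.Partition) : rowLen lam ∈ diagrams n n := by
  refine mem_diagrams.2 ⟨sum_rowLen lam, fun i hi => ?_, rowLen_antitone lam⟩
  by_contra h
  have := (lt_rowLen_iff lam i 0).1 (Nat.pos_of_ne_zero h)
  have := colLen_le lam 0
  omega

theorem rowLen_injective (n : ℕ) : Function.Injective (rowLen (n := n)) := by
  intro lam mu h
  have hcol : ∀ j, colLen lam j = colLen mu j := fun j => by
    rw [← colCount_rowLen, ← colCount_rowLen, h]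
  have hcount : ∀ (nu : n.Partition) (p : ℕ),
      colLen nu p = nu.parts.count (p + 1) + colLen nu (p + 1) := by
    intro nu p
    rw [colLen, colLen, Multiset.count_eq_card_filter_eq, ← Multiset.card_add]
    congr 1
    rw [Multiset.filter_add_filter, Multiset.filter_eq_nil (p := fun q => p + 1 = q ∧ p + 1 < q).2
      fun q _ => by omega, add_zero]
    exact Multiset.filter_congr fun q _ => by omega
  refine Nat.Partition.ext (Multiset.ext.2 fun p => ?_)
  cases p with
  | zero =>
    rw [Multiset.count_eq_zero_of_notMem fun h => (lam.parts_pos h).false,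
      Multiset.count_eq_zero_of_notMem fun h => (mu.parts_pos h).false]
  | succ p =>
    have h1 := hcount lam p
    have h2 := hcount mu p
    rw [hcol, hcol] at h1
    omega

theorem prod_cells {n : ℕ} (lam : n.Partition) (F : ℕ → ℕ → ℝ) :
    ∏ s ∈ cells lam, F s.1 s.2 = ∏ i ∈ range n, ∏ j ∈ range (rowLen lam i), F i j := by
  rw [cells, prod_filter, prod_product]
  refine prod_congr rfl fun i _ => ?_
  rw [← prod_filter]
  congr 1
  ext j
  have : rowLen lam i ≤ n := colCount_le n (colLen lam) i
  simp only [mem_filter, mem_range]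
  omega

theorem cLow_mul_cUp (α : ℝ) {n : ℕ} (lam : n.Partition) :
    cLow α lam * cUp α lam = jackHook α n (rowLen lam) := by
  have key : ∀ c : ℝ, ∏ s ∈ cells lam, (α * arm lam s + leg lam s + c) =
      hookProd α c n (rowLen lam) := by
    intro c
    rw [hookProd]
    simp only [colCount_rowLen]
    exact prod_cells lam fun i j =>
      α * (rowLen lam i - (j + 1) : ℕ) + (colLen lam j - (i + 1) : ℕ) + c
  rw [cLow, cUp, key, key, jackHook]

/-- The Jack probability that the largest part equals `l` is at most
`n!/((n-l)! l!) ⬝ 1/(α^(l-1) (l-1)!)`. -/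
theorem jack_prob_largest_part_eq (α : ℝ) (hα : 0 < α) (n : ℕ) (hn : 1 ≤ n)
    (l : ℕ) (hl : 1 ≤ l) (hln : l ≤ n) :
    (∑ lam : n.Partition, if rowLen lam 0 = l then jackP α lam else 0) ≤
      (n.factorial : ℝ) / ((n - l).factorial * l.factorial) *
        (1 / (α ^ (l - 1) * (l - 1).factorial)) := by
  classical
  obtain ⟨k, rfl⟩ : ∃ k, l = k + 1 := ⟨l - 1, by omega⟩
  obtain ⟨m, rfl⟩ : ∃ m, n = m + (k + 1) := ⟨n - (k + 1), by omega⟩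
  have hmass : 0 < α ^ (m + (k + 1)) * (m + (k + 1)).factorial := by positivity
  calc ∑ lam : (m + (k + 1)).Partition, (if rowLen lam 0 = k + 1 then jackP α lam else 0)
      = ∑ f ∈ image (rowLen (n := m + (k + 1))) univ, (if f 0 = k + 1 then
          α ^ (m + (k + 1)) * (m + (k + 1)).factorial * (jackHook α (m + (k + 1)) f)⁻¹
            else 0) := by
        rw [sum_image (rowLen_injective _).injOn]
        simp only [jackP, cLow_mul_cUp, div_eq_mul_inv]
    _ ≤ ∑ f ∈ diagrams (m + k + 1) (m + (k + 1)), (if f 0 = k + 1 then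
          α ^ (m + (k + 1)) * (m + (k + 1)).factorial * (jackHook α (m + k + 1) f)⁻¹
            else 0) := by
        refine sum_le_sum_of_subset_of_nonneg (fun f hf => ?_) fun f _ _ => ?_
        · obtain ⟨lam, -, rfl⟩ := mem_image.1 hf
          exact rowLen_mem_diagrams lam
        · split_ifs
          · exact mul_nonneg hmass.le (inv_pos.2 (jackHook_pos hα _ f)).le
          · exact le_rfl
    _ = α ^ (m + (k + 1)) * (m + (k + 1)).factorial *
          ∑ f ∈ diagrams (m + k + 1) (m + (k + 1)) with f 0 = k + 1,
            (jackHook α (m + k + 1) f)⁻¹ := by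
        rw [← sum_filter, mul_sum]
    _ ≤ α ^ (m + (k + 1)) * (m + (k + 1)).factorial * (1 / (α ^ m * m.factorial) *
          (1 / (α ^ k * k.factorial * (α ^ (k + 1) * (k + 1).factorial)))) :=
        mul_le_mul_of_nonneg_left (sum_inv_jackHook_first_row_le hα (m + k) m k) hmass.le
    _ = _ := by
        rw [Nat.add_sub_cancel, Nat.add_sub_cancel, pow_add]
        field_simp

end JackTest
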